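/- Let u be a smooth function, ℓ ≥ 0 an integer, and let f₀ = 1, f₁, …, f_ℓ be smooth functions; set F(x;λ) = Σ_{j=0}^{ℓ} f_{ℓ−j}(x) λ^j and suppose the stationary KdV identity ∂ₓ³F(x;λ) = 4(u(x) − λ) ∂ₓF(x;λ) + 2u′(x) F(x;λ) holds identically in x and λ. Let L = −d²/dx² + u and define the differential operator P = Σ_{j=0}^{ℓ} ( f_{ℓ−j}(x) (d/dx) − (1/2) f′_{ℓ−j}(x) ) L^j of order 2ℓ+1, and the polynomial Q(λ) = (1/2) F″(x;λ) F(x;λ) − (1/4)(F′(x;λ))² − (u(x) − λ) F(x;λ)², where primes denote x-derivatives. Then: (a) Q(λ) is independent of x and is a monic polynomial in λ of degree 2ℓ+1; (b) P commutes with L as differential operators acting on smooth functions; (c) (Burchnall–Chaundy identity) P² = −Q(L), i.e. for every smooth ψ, P(Pψ) = −Q(L)ψ, where Q(L) is obtained by substituting L for λ in Q. -/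

import Mathlib

open Finset

open Polynomial

namespace BurchnallChaundy

section Algebra

variable {k A : Type*} [Field k] [CommRing A] [Algebra k A] (D : Derivation k A A)

/-- The derivation of `A[X]` that applies `D` to every coefficient and kills `X`. -/
noncomputable def coeffDeriv : Derivation k A[X] A[X] :=
  PolynomialModule.equivPolynomialSelf.compDer D.mapCoeffs

@[simp]
lemma coeff_coeffDeriv (G : A[X]) (n : ℕ) : (coeffDeriv D G).coeff n = D (G.coeff n) := rfl

@[simp]
lemma coeffDeriv_monomial (n : ℕ) (a : A) :
    coeffDeriv D (monomial n a) = monomial n (D a) := by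
  ext m
  simp only [coeff_coeffDeriv, coeff_monomial]
  split_ifs <;> simp

@[simp]
lemma coeffDeriv_C (a : A) : coeffDeriv D (C a) = C (D a) := coeffDeriv_monomial D 0 a

@[simp]
lemma coeffDeriv_X : coeffDeriv D (X : A[X]) = 0 := by
  rw [← monomial_one_one_eq_X, coeffDeriv_monomial]
  simp

lemma eval_coeffDeriv (c : k) (G : A[X]) :
    (coeffDeriv D G).eval (algebraMap k A c) = D (G.eval (algebraMap k A c)) := by
  induction G using Polynomial.induction_on' with
  | add p q hp hq => simp [hp, hq]
  | monomial n a => simp [← map_pow, mul_comm]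

/-- The `A`-linear map `∑ aⱼ Xʲ ↦ ∑ aⱼ vⱼ` given by a sequence `v`. -/
noncomputable def evalSeq (v : ℕ → A) : A[X] →ₗ[A] A :=
  Polynomial.lsum fun j => LinearMap.toSpanSingleton A A (v j)

@[simp]
lemma evalSeq_monomial (v : ℕ → A) (n : ℕ) (a : A) : evalSeq v (monomial n a) = a * v n := by
  simp [evalSeq, Polynomial.lsum, Polynomial.sum_monomial_index]

lemma evalSeq_eq_sum_range (v : ℕ → A) {G : A[X]} {n : ℕ} (h : G.natDegree < n) :
    evalSeq v G = ∑ j ∈ Finset.range n, G.coeff j * v j :=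
  Polynomial.sum_over_range' G (fun _ => by simp) n h

lemma evalSeq_C_mul (v : ℕ → A) (a : A) (G : A[X]) :
    evalSeq v (C a * G) = a * evalSeq v G := by
  rw [← smul_eq_C_mul, map_smul, smul_eq_mul]

lemma evalSeq_X_mul (v : ℕ → A) (G : A[X]) :
    evalSeq v (X * G) = evalSeq (fun j => v (j + 1)) G := by
  induction G using Polynomial.induction_on' with
  | add p q hp hq => simp [mul_add, hp, hq]
  | monomial n a => simp [X_mul_monomial]

lemma derivation_evalSeq (v : ℕ → A) (G : A[X]) :
    D (evalSeq v G) = evalSeq v (coeffDeriv D G) + evalSeq (fun j => D (v j)) G := by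
  induction G using Polynomial.induction_on' with
  | add p q hp hq => simp only [map_add, hp, hq]; ring
  | monomial n a => simp; ring

variable (u : A)

/-- The Schrödinger operator `-D² + u`. -/
def schrodinger (ψ : A) : A := -D (D ψ) + u * ψ

/-- `jet D u ψ G H = ∑ Gⱼ Lʲψ + ∑ Hⱼ D(Lʲψ)` where `L = -D² + u`. -/
noncomputable def jet (ψ : A) (G H : A[X]) : A :=
  evalSeq (fun j => (schrodinger D u)^[j] ψ) G +
    evalSeq (fun j => D ((schrodinger D u)^[j] ψ)) H

lemma derivation_jet (ψ : A) (G H : A[X]) :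
    D (jet D u ψ G H) =
      jet D u ψ (coeffDeriv D G + (C u - X) * H) (coeffDeriv D H + G) := by
  have key : evalSeq (fun j => D (D ((schrodinger D u)^[j] ψ))) H =
      evalSeq (fun j => (schrodinger D u)^[j] ψ) ((C u - X) * H) := by
    rw [sub_mul, map_sub, evalSeq_C_mul, evalSeq_X_mul]
    induction H using Polynomial.induction_on' with
    | add p q hp hq => simp only [map_add, hp, hq]; ring
    | monomial n a =>
      simp only [evalSeq_monomial, Function.iterate_succ_apply']
      rw [schrodinger]
      ring
  simp only [jet, map_add, derivation_evalSeq, key]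
  ring

lemma schrodinger_jet (ψ : A) (G H : A[X]) :
    schrodinger D u (jet D u ψ G H) =
      jet D u ψ
        (-coeffDeriv D (coeffDeriv D G + (C u - X) * H) - (C u - X) * (coeffDeriv D H + G)
          + C u * G)
        (-coeffDeriv D (coeffDeriv D H + G) - (coeffDeriv D G + (C u - X) * H) + C u * H) := by
  rw [schrodinger, derivation_jet, derivation_jet]
  simp only [jet, map_add, map_sub, map_neg, evalSeq_C_mul]
  ring

lemma jet_schrodinger (ψ : A) (G H : A[X]) :
    jet D u (schrodinger D u ψ) G H = jet D u ψ (X * G) (X * H) := by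
  simp only [jet, evalSeq_X_mul, ← Function.iterate_succ_apply]

lemma jet_iterate_schrodinger (ψ : A) (G H : A[X]) (n : ℕ) :
    jet D u ((schrodinger D u)^[n] ψ) G H = jet D u ψ (X ^ n * G) (X ^ n * H) := by
  induction n generalizing G H with
  | zero => simp
  | succ n ih =>
    rw [Function.iterate_succ_apply', jet_schrodinger, ih, pow_succ, mul_assoc, mul_assoc]

lemma evalSeq_jet (ψ : A) (G H K : A[X]) :
    evalSeq (fun j => jet D u ((schrodinger D u)^[j] ψ) G H) K =
      jet D u ψ (K * G) (K * H) := by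
  simp only [jet_iterate_schrodinger]
  induction K using Polynomial.induction_on' with
  | add p q hp hq => rw [map_add, hp, hq]; simp only [jet, add_mul, map_add]; ring
  | monomial n a =>
    rw [evalSeq_monomial, ← C_mul_X_pow_eq_monomial]
    simp only [jet, mul_assoc, evalSeq_C_mul]
    ring

/-- The operator `∑ (Fⱼ D - ½ D(Fⱼ)) Lʲ` attached to the polynomial `F = ∑ Fⱼ Xʲ`. -/
noncomputable def laxOperator (F : A[X]) (ψ : A) : A :=
  jet D u ψ (-(C (algebraMap k A (1 / 2)) * coeffDeriv D F)) F

/-- The polynomial `½ F'' F - ¼ F'² - (u - X) F²`. -/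
noncomputable def spectralPoly (F : A[X]) : A[X] :=
  C (algebraMap k A (1 / 2)) * coeffDeriv D (coeffDeriv D F) * F
    - C (algebraMap k A (1 / 2)) ^ 2 * coeffDeriv D F ^ 2 - (C u - X) * F ^ 2

/-- The stationary KdV identity `F''' = 4 (u - X) F' + 2 u' F`. -/
def IsStationaryKdV (F : A[X]) : Prop :=
  coeffDeriv D (coeffDeriv D (coeffDeriv D F)) =
    4 * (C u - X) * coeffDeriv D F + 2 * C (D u) * F

variable [NeZero (2 : k)]

lemma two_mul_C_half : (2 : A[X]) * C (algebraMap k A (1 / 2)) = 1 := by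
  have h : (2 : A) * algebraMap k A (1 / 2) = 1 := by
    rw [← map_ofNat (algebraMap k A) 2, ← map_mul, mul_one_div_cancel two_ne_zero, map_one]
  rw [← C_1, ← h, C_mul, C_ofNat]

variable {D u} {F : A[X]}

lemma IsStationaryKdV.coeffDeriv_spectralPoly (hF : IsStationaryKdV D u F) :
    coeffDeriv D (spectralPoly D u F) = 0 := by
  have h := two_mul_C_half (k := k) (A := A)
  unfold IsStationaryKdV at hF
  simp only [spectralPoly, map_sub, Derivation.leibniz, Derivation.leibniz_pow, coeffDeriv_C,
    coeffDeriv_X, smul_eq_mul, Derivation.map_algebraMap, map_zero, hF, nsmul_eq_mul]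
  set c : A[X] := C (algebraMap k A (1 / 2))
  set F₁ := coeffDeriv D F
  set F₂ := coeffDeriv D F₁
  push_cast
  linear_combination ((2 * (C u - X) * F * F₁ + C (D u) * F ^ 2) - c * F₁ * F₂ ) * h

lemma IsStationaryKdV.schrodinger_laxOperator (hF : IsStationaryKdV D u F) (ψ : A) :
    schrodinger D u (laxOperator D u F ψ) = laxOperator D u F (schrodinger D u ψ) := by
  have h := two_mul_C_half (k := k) (A := A)
  unfold IsStationaryKdV at hF
  rw [laxOperator, laxOperator, schrodinger_jet, jet_schrodinger]
  simp only [map_add, map_neg, map_sub, Derivation.leibniz, coeffDeriv_C, coeffDeriv_X,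
    smul_eq_mul, Derivation.map_algebraMap, map_zero, hF]
  set c : A[X] := C (algebraMap k A (1 / 2))
  set F₁ := coeffDeriv D F
  set F₂ := coeffDeriv D F₁
  congr 1
  · linear_combination (2 * (C u - X) * F₁ + C (D u) * F) * h
  · linear_combination F₂ * h

lemma IsStationaryKdV.iterate_schrodinger_laxOperator (hF : IsStationaryKdV D u F) (ψ : A)
    (n : ℕ) :
    (schrodinger D u)^[n] (laxOperator D u F ψ) =
      laxOperator D u F ((schrodinger D u)^[n] ψ) := by
  induction n with
  | zero => rfl
  | succ n ih =>
    rw [Function.iterate_succ_apply', ih, hF.schrodinger_laxOperator,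
      Function.iterate_succ_apply']

/-- The Burchnall–Chaundy identity. -/
lemma IsStationaryKdV.laxOperator_laxOperator (hF : IsStationaryKdV D u F) (ψ : A) :
    laxOperator D u F (laxOperator D u F ψ) =
      -evalSeq (fun j => (schrodinger D u)^[j] ψ) (spectralPoly D u F) := by
  have h := two_mul_C_half (k := k) (A := A)
  rw [laxOperator, jet]
  simp only [hF.iterate_schrodinger_laxOperator]
  simp only [laxOperator, derivation_jet, evalSeq_jet]
  simp only [map_neg, Derivation.leibniz, coeffDeriv_C, smul_eq_mul, Derivation.map_algebraMap,
    map_zero, spectralPoly]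
  set c : A[X] := C (algebraMap k A (1 / 2))
  set F₁ := coeffDeriv D F
  set F₂ := coeffDeriv D F₁
  rw [jet, jet, add_add_add_comm, ← map_add, ← map_add, ← map_neg]
  rw [show -(c * F₁) * F + F * (F₁ + -(c * F₁)) = 0 by linear_combination -F * F₁ * h, map_zero,
    add_zero]
  congr 1
  ring

end Algebra

section Smooth

open scoped ContDiff

/-- The algebra of smooth functions `ℝ → ℂ`. -/
def smoothFun : Subalgebra ℂ (ℝ → ℂ) where
  carrier := {g | ContDiff ℝ ∞ g}
  mul_mem' := fun {f g} (hf : ContDiff ℝ ∞ f) (hg : ContDiff ℝ ∞ g) => hf.mul hg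
  add_mem' := fun {f g} (hf : ContDiff ℝ ∞ f) (hg : ContDiff ℝ ∞ g) => hf.add hg
  algebraMap_mem' := fun c => (contDiff_const : ContDiff ℝ ∞ fun _ : ℝ => c)

lemma smoothFun.differentiable (g : smoothFun) : Differentiable ℝ (g : ℝ → ℂ) :=
  (contDiff_infty_iff_deriv.mp g.2).1

/-- Differentiation as a derivation of the algebra of smooth functions. -/
noncomputable def smoothDeriv : Derivation ℂ smoothFun smoothFun :=
  Derivation.mk'
    { toFun := fun g => ⟨deriv (g : ℝ → ℂ), (contDiff_infty_iff_deriv.mp g.2).2⟩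
      map_add' := fun f g => Subtype.ext <| funext fun x =>
        deriv_add (smoothFun.differentiable f x) (smoothFun.differentiable g x)
      map_smul' := fun c g => Subtype.ext <| funext fun x =>
        deriv_const_mul c (smoothFun.differentiable g x) }
    fun f g => Subtype.ext <| funext fun x => by
      have := deriv_mul (smoothFun.differentiable f x) (smoothFun.differentiable g x)
      simp only [LinearMap.coe_mk, AddHom.coe_mk, smul_eq_mul]
      refine this.trans ?_
      simp [add_comm, mul_comm]

@[simp]
lemma coe_smoothDeriv (g : smoothFun) : (smoothDeriv g : ℝ → ℂ) = deriv (g : ℝ → ℂ) := rfl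

/-- Evaluation of smooth functions at a point. -/
def evalAt (x : ℝ) : smoothFun →ₐ[ℂ] ℂ := (Pi.evalAlgHom ℂ (fun _ : ℝ => ℂ) x).comp smoothFun.val

@[simp]
lemma evalAt_apply (x : ℝ) (g : smoothFun) : evalAt x g = (g : ℝ → ℂ) x := rfl

lemma eval_map_evalAt (x : ℝ) (c : ℂ) (G : smoothFun[X]) :
    (G.map (evalAt x : smoothFun →+* ℂ)).eval c =
      ((G.eval (algebraMap ℂ smoothFun c) : smoothFun) : ℝ → ℂ) x := by
  have h := eval₂_at_apply (p := G) (evalAt x : smoothFun →+* ℂ) (algebraMap ℂ smoothFun c)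
  rw [RingHom.coe_coe, AlgHom.commutes] at h
  rw [eval_map]
  exact h

lemma polynomial_ext_of_eval {G H : smoothFun[X]}
    (h : ∀ c : ℂ, G.eval (algebraMap ℂ smoothFun c) = H.eval (algebraMap ℂ smoothFun c)) :
    G = H := by
  ext n : 1
  refine Subtype.ext <| funext fun x => ?_
  have : G.map (evalAt x : smoothFun →+* ℂ) = H.map (evalAt x : smoothFun →+* ℂ) :=
    Polynomial.funext fun c => by rw [eval_map_evalAt, eval_map_evalAt, h]
  simpa using congrArg (fun p => p.coeff n) this

lemma map_evalAt_of_coeffDeriv_eq_zero {G : smoothFun[X]}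
    (h : coeffDeriv smoothDeriv G = 0) (x : ℝ) :
    (G.map (evalAt x : smoothFun →+* ℂ)).map (algebraMap ℂ smoothFun) = G := by
  ext n : 1
  refine Subtype.ext <| funext fun y => ?_
  have h0 : smoothDeriv (G.coeff n) = 0 := by rw [← coeff_coeffDeriv, h, coeff_zero]
  have h1 : ∀ z, deriv (G.coeff n : ℝ → ℂ) z = 0 := fun z => congrFun (congrArg Subtype.val h0) z
  simpa using is_const_of_deriv_eq_zero (smoothFun.differentiable _) h1 x y

lemma iterate_coe {L : (ℝ → ℂ) → (ℝ → ℂ)} {S : smoothFun → smoothFun}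
    (h : ∀ ψ : smoothFun, L ψ = S ψ) (n : ℕ) (ψ : smoothFun) :
    L^[n] ψ = (S^[n] ψ : smoothFun) := by
  induction n with
  | zero => rfl
  | succ n ih => rw [Function.iterate_succ_apply', ih, h, Function.iterate_succ_apply']

end Smooth

section Monic

variable {R : Type*} [CommRing R] [Nontrivial R]

lemma monic_and_natDegree_eq_of_monic {n : ℕ} {h g g' : R[X]} {a c : R} (hh : h.Monic)
    (hd : h.natDegree = n) (hg : g.natDegree ≤ n) (hg' : g'.natDegree ≤ n) :
    (C a * g * h - C a ^ 2 * g' ^ 2 - (C c - X) * h ^ 2).Monic ∧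
      (C a * g * h - C a ^ 2 * g' ^ 2 - (C c - X) * h ^ 2).natDegree = 2 * n + 1 := by
  have e : C a * g * h - C a ^ 2 * g' ^ 2 - (C c - X) * h ^ 2 =
      X * h ^ 2 + (C a * (g * h) - C a ^ 2 * g' ^ 2 - C c * h ^ 2) := by ring
  have hX : (X * h ^ 2).Monic := monic_X.mul (hh.pow 2)
  have hXd : (X * h ^ 2).natDegree = 2 * n + 1 := by
    rw [monic_X.natDegree_mul (hh.pow 2), hh.natDegree_pow, hd, natDegree_X, add_comm]
  have hr : (C a * (g * h) - C a ^ 2 * g' ^ 2 - C c * h ^ 2).natDegree < 2 * n + 1 := by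
    have h1 : (C a * (g * h)).natDegree ≤ 2 * n :=
      (natDegree_C_mul_le _ _).trans <| natDegree_mul_le.trans (by omega)
    have h2 : (C a ^ 2 * g' ^ 2).natDegree ≤ 2 * n := by
      rw [← C_pow]
      exact (natDegree_C_mul_le _ _).trans <| natDegree_pow_le.trans (by omega)
    have h3 : (C c * h ^ 2).natDegree ≤ 2 * n :=
      (natDegree_C_mul_le _ _).trans <| natDegree_pow_le.trans (by omega)
    exact Nat.lt_succ_of_le <|
      natDegree_sub_le_of_le (natDegree_sub_le_of_le h1 h2) h3 |>.trans (by simp)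
  rw [← hXd] at hr
  rw [e]
  exact ⟨hX.add_of_left (degree_lt_degree hr),
    (natDegree_add_eq_left_of_natDegree_lt hr).trans hXd⟩

end Monic

end BurchnallChaundy

open BurchnallChaundy

/-- an explicit Burchnall–Chaundy theorem.
Let `u` be smooth, `ℓ ≥ 0`, `f 0 = 1`, `f 1, …, f ℓ` smooth, and let
`F lam x = ∑_{j=0}^{ℓ} f (ℓ - j) x * lam ^ j` satisfy the stationary KdV identity
`F''' = 4 (u - lam) F' + 2 u' F` (derivatives in `x`) identically in `x` and `lam`.
With `L = -d²/dx² + u`, `P = ∑_{j=0}^{ℓ} (f (ℓ-j) d/dx - (1/2) (f (ℓ-j))') L^j` and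
`Q lam = (1/2) F'' F - (1/4) (F')² - (u - lam) F²`, we have:
(a) `Q lam` is independent of `x` and is (given by) a monic polynomial of degree `2ℓ+1` in `lam`;
(b) `P` commutes with `L` on smooth functions;
(c) `P² = -Q(L)` on smooth functions. -/
theorem stmt_19 (ℓ : ℕ) (u : ℝ → ℂ) (hu : ContDiff ℝ (⊤ : ℕ∞) u)
    (f : ℕ → ℝ → ℂ) (hf0 : f 0 = fun _ => (1 : ℂ))
    (hf : ∀ j ≤ ℓ, ContDiff ℝ (⊤ : ℕ∞) (f j))
    (F : ℂ → ℝ → ℂ)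
    (hF : ∀ lam x, F lam x = ∑ j ∈ Finset.range (ℓ + 1), f (ℓ - j) x * lam ^ j)
    (hKdV : ∀ lam x, deriv (deriv (deriv (F lam))) x
      = 4 * (u x - lam) * deriv (F lam) x + 2 * deriv u x * F lam x)
    (L : (ℝ → ℂ) → (ℝ → ℂ))
    (hL : ∀ ψ, L ψ = fun x => -(deriv (deriv ψ) x) + u x * ψ x)
    (P : (ℝ → ℂ) → (ℝ → ℂ))
    (hP : ∀ ψ, P ψ = fun x => ∑ j ∈ Finset.range (ℓ + 1),
      (f (ℓ - j) x * deriv (L^[j] ψ) x - (1 / 2) * deriv (f (ℓ - j)) x * (L^[j] ψ) x))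
    (Q : ℂ → ℝ → ℂ)
    (hQ : ∀ lam x, Q lam x
      = (1 / 2) * deriv (deriv (F lam)) x * F lam x - (1 / 4) * (deriv (F lam) x) ^ 2
        - (u x - lam) * (F lam x) ^ 2) :
    -- (a) : `Q` is independent of `x`
    (∀ lam : ℂ, ∀ x y : ℝ, Q lam x = Q lam y)
    ∧
    -- (b) : `P` commutes with `L` on smooth functions
    (∀ ψ : ℝ → ℂ, ContDiff ℝ (⊤ : ℕ∞) ψ → ∀ x : ℝ, P (L ψ) x = L (P ψ) x)
    ∧
    -- (a)+(c) : `Q` is a monic polynomial of degree `2ℓ+1` and `P² = -Q(L)`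
    (∃ q : Polynomial ℂ, q.Monic ∧ q.natDegree = 2 * ℓ + 1
      ∧ (∀ lam x, Q lam x = q.eval lam)
      ∧ (∀ ψ : ℝ → ℂ, ContDiff ℝ (⊤ : ℕ∞) ψ → ∀ x : ℝ,
          P (P ψ) x = -(∑ k ∈ Finset.range (2 * ℓ + 2), q.coeff k * (L^[k] ψ) x))) := by
  let U : smoothFun := ⟨u, hu⟩
  let a : ℕ → smoothFun := fun j => ⟨f (ℓ - j), hf _ (Nat.sub_le _ _)⟩
  let G : smoothFun[X] := ∑ j ∈ Finset.range (ℓ + 1), monomial j (a j)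
  let q : ℂ[X] := (spectralPoly smoothDeriv U G).map (evalAt 0 : smoothFun →+* ℂ)
  have hFG : ∀ lam, F lam = (G.eval (algebraMap ℂ smoothFun lam) : smoothFun) := by
    intro lam
    funext x
    rw [hF, ← evalAt_apply, eval_finsetSum, map_sum]
    simp [a]
  have hF1 : ∀ lam, deriv (F lam) =
      ((coeffDeriv smoothDeriv G).eval (algebraMap ℂ smoothFun lam) : smoothFun) := by
    intro lam
    rw [hFG, eval_coeffDeriv, coe_smoothDeriv]
  have hF2 : ∀ lam, deriv (deriv (F lam)) =
      ((coeffDeriv smoothDeriv (coeffDeriv smoothDeriv G)).eval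
        (algebraMap ℂ smoothFun lam) : smoothFun) := by
    intro lam
    rw [hF1, eval_coeffDeriv _ _ (coeffDeriv smoothDeriv G), coe_smoothDeriv]
  have hG : IsStationaryKdV smoothDeriv U G := by
    refine polynomial_ext_of_eval fun lam => Subtype.ext <| funext fun x => ?_
    have h := hKdV lam x
    rw [hF2, hF1, hFG] at h
    rw [eval_coeffDeriv, coe_smoothDeriv, h]
    simp only [← evalAt_apply]
    simp [U]
    rfl
  have hq : q.map (algebraMap ℂ smoothFun) = spectralPoly smoothDeriv U G :=
    map_evalAt_of_coeffDeriv_eq_zero hG.coeffDeriv_spectralPoly 0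
  have hQq : ∀ lam x, Q lam x = q.eval lam := by
    intro lam x
    have h : ((spectralPoly smoothDeriv U G).eval (algebraMap ℂ smoothFun lam)) =
        algebraMap ℂ smoothFun (q.eval lam) := by
      rw [← hq, eval_map_algebraMap, aeval_algebraMap_apply_eq_algebraMap_eval]
    have h' := congrArg (evalAt x) h
    rw [AlgHom.commutes] at h'
    rw [hQ, hF2, hF1, hFG]
    simp only [← evalAt_apply]
    refine Eq.trans ?_ h'
    simp [spectralPoly, U]
    exact Or.inl (by norm_num)
  have hLS : ∀ ψ : smoothFun, L ψ = schrodinger smoothDeriv U ψ := fun ψ => hL ψ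
  have hPS : ∀ ψ : smoothFun, P ψ = laxOperator smoothDeriv U G ψ := by
    intro ψ
    funext x
    rw [hP, ← evalAt_apply]
    simp only [iterate_coe hLS]
    simp only [laxOperator, jet, G, map_sum, coeffDeriv_monomial, Finset.mul_sum, map_neg,
      evalSeq_C_mul, evalSeq_monomial, map_add, ← Finset.sum_neg_distrib, ← Finset.sum_add_distrib]
    refine Finset.sum_congr rfl fun j _ => ?_
    simp [a]
    ring
  have hmon : q.Monic ∧ q.natDegree = 2 * ℓ + 1 := by
    have hdeg : ∀ b : ℕ → smoothFun,
        (∑ j ∈ Finset.range (ℓ + 1), monomial j (b j)).natDegree ≤ ℓ := fun b =>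
      natDegree_sum_le_of_forall_le _ _ fun j hj =>
        (natDegree_monomial_le _).trans (Nat.lt_succ_iff.mp (Finset.mem_range.mp hj))
    have hcoeff : (G.map (evalAt 0 : smoothFun →+* ℂ)).coeff ℓ = 1 := by
      simp [G, coeff_monomial, a, hf0]
    have hGm : (G.map (evalAt 0 : smoothFun →+* ℂ)).natDegree ≤ ℓ :=
      natDegree_map_le.trans (hdeg a)
    have hD : ∀ H : smoothFun[X], (coeffDeriv smoothDeriv H).natDegree ≤ H.natDegree := fun H =>
      natDegree_le_iff_coeff_eq_zero.mpr fun n hn => by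
        rw [coeff_coeffDeriv, coeff_eq_zero_of_natDegree_lt hn, map_zero]
    have hm := monic_of_natDegree_le_of_coeff_eq_one ℓ hGm hcoeff
    have := monic_and_natDegree_eq_of_monic (a := 1 / 2) (c := u 0) hm
      (le_antisymm hGm (le_natDegree_of_ne_zero (by rw [hcoeff]; exact one_ne_zero)))
      (natDegree_map_le.trans ((hD _).trans ((hD G).trans (hdeg a))) :
        ((coeffDeriv smoothDeriv (coeffDeriv smoothDeriv G)).map
          (evalAt 0 : smoothFun →+* ℂ)).natDegree ≤ ℓ)
      (natDegree_map_le.trans ((hD G).trans (hdeg a)) :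
        ((coeffDeriv smoothDeriv G).map (evalAt 0 : smoothFun →+* ℂ)).natDegree ≤ ℓ)
    convert! this using 2 <;> simp [q, spectralPoly, U]
  refine ⟨fun lam x y => by rw [hQq, hQq], fun ψ hψ x => ?_, q, hmon.1, hmon.2, hQq,
    fun ψ hψ x => ?_⟩
  · change P (L (⟨ψ, hψ⟩ : smoothFun)) x = L (P (⟨ψ, hψ⟩ : smoothFun)) x
    rw [hLS, hPS, hPS, hLS, hG.schrodinger_laxOperator]
  · change P (P (⟨ψ, hψ⟩ : smoothFun)) x =
      -∑ k ∈ Finset.range (2 * ℓ + 2), q.coeff k * (L^[k] (⟨ψ, hψ⟩ : smoothFun)) x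
    have hdeg : (q.map (algebraMap ℂ smoothFun)).natDegree < 2 * ℓ + 2 :=
      natDegree_map_le.trans_lt (by omega)
    rw [hPS, hPS, hG.laxOperator_laxOperator, ← hq, ← evalAt_apply,
      evalSeq_eq_sum_range _ hdeg, map_neg, map_sum]
    refine congrArg _ (Finset.sum_congr rfl fun j _ => ?_)
    rw [iterate_coe hLS, map_mul, coeff_map, AlgHom.commutes]
    rfl
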